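/- arXiv:1106.3978 — 2 statements merged into one kernel-verified Lean document; each statement's English description precedes it below -/
import Mathlib

section
/- Let M be a free abelian group of finite rank, V and W subgroups of M, and φ : V → W a group isomorphism. Then D_φ is a φ_ℚ-invariant ℚ-subspace of M⊗ℚ, and the restriction φ̃ of φ_ℚ to D_φ maps D_φ bijectively onto D_φ; that is, φ̃ is a ℚ-linear automorphism of D_φ. -/
/-!
Setting: `M = ℤ^n` is a free abelian group of finite rank, `V, W` are subgroups of `M`,
and `φ : V ≃+ W` is a group isomorphism.  Inside `M ⊗ ℚ = ℚ^n`, a subgroup `U` of `M`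
is identified with the `ℚ`-subspace `U ⊗ ℚ` spanned by its image, and `φ_ℚ` denotes the
unique `ℚ`-linear extension of `φ` to `V ⊗ ℚ`.
-/

/-- The canonical embedding of `ℤ^n` into `ℚ^n` (i.e. `M → M ⊗ ℚ`). -/
def embQ (n : ℕ) (x : Fin n → ℤ) : Fin n → ℚ := fun i => (x i : ℚ)

/-- `U ⊗ ℚ`, the `ℚ`-subspace of `ℚ^n` spanned by the image of a subgroup `U` of `ℤ^n`. -/
def qSpan (n : ℕ) (U : AddSubgroup (Fin n → ℤ)) : Submodule ℚ (Fin n → ℚ) :=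
  Submodule.span ℚ (embQ n '' (U : Set (Fin n → ℤ)))

/-- `RelQ V W φ x y` expresses that `x ∈ V ⊗ ℚ` and `φ_ℚ (x) = y`, where `φ_ℚ` is the
unique `ℚ`-linear extension of `φ : V ≃+ W`: there is a nonzero integer `p` clearing the
denominators of `x`, with `p • x ∈ V` and `φ (p • x) = p • y`. -/
def RelQ {n : ℕ} (V W : AddSubgroup (Fin n → ℤ)) (φ : V ≃+ W)
    (x y : Fin n → ℚ) : Prop :=
  ∃ p : ℤ, p ≠ 0 ∧ ∃ v : V, embQ n (v : Fin n → ℤ) = p • x ∧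
    embQ n ((φ v : W) : Fin n → ℤ) = p • y

/-- `D_φ`: the set of `x ∈ (V ∩ W) ⊗ ℚ` admitting a full backward orbit
`(x_k)_{k ≥ 0}` under `φ_ℚ` inside `(V ∩ W) ⊗ ℚ`, i.e. `x_0 = x` and
`φ_ℚ (x_{k+1}) = x_k` for all `k`. -/
def DSet {n : ℕ} (V W : AddSubgroup (Fin n → ℤ)) (φ : V ≃+ W) : Set (Fin n → ℚ) :=
  {x | ∃ xs : ℕ → (Fin n → ℚ), xs 0 = x ∧ (∀ k, xs k ∈ qSpan n (V ⊓ W)) ∧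
      ∀ k, RelQ V W φ (xs (k + 1)) (xs k)}

theorem embQ_add (n : ℕ) (x y : Fin n → ℤ) : embQ n (x + y) = embQ n x + embQ n y := by
  funext i; simp [embQ]

theorem embQ_zsmul (n : ℕ) (a : ℤ) (x : Fin n → ℤ) : embQ n (a • x) = a • embQ n x := by
  funext i; simp [embQ]

theorem embQ_inj (n : ℕ) {x y : Fin n → ℤ} (h : embQ n x = embQ n y) : x = y := by
  funext i
  have := congrFun h i
  simpa [embQ] using this

theorem RelQ.add {n : ℕ} {V W : AddSubgroup (Fin n → ℤ)} {φ : V ≃+ W} {x y x' y' : Fin n → ℚ}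
    (h : RelQ V W φ x y) (h' : RelQ V W φ x' y') : RelQ V W φ (x + x') (y + y') := by
  obtain ⟨p, hp, v, h1, h2⟩ := h
  obtain ⟨q, hq, w, h3, h4⟩ := h'
  refine ⟨p * q, mul_ne_zero hp hq, q • v + p • w, ?_, ?_⟩
  · rw [AddSubgroup.coe_add, AddSubgroup.coe_zsmul, AddSubgroup.coe_zsmul, embQ_add, embQ_zsmul,
      embQ_zsmul, h1, h3, smul_add, smul_smul, smul_smul, mul_comm q p]
  · rw [map_add, map_zsmul, map_zsmul, AddSubgroup.coe_add, AddSubgroup.coe_zsmul,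
      AddSubgroup.coe_zsmul, embQ_add, embQ_zsmul,
      embQ_zsmul, h2, h4, smul_add, smul_smul, smul_smul, mul_comm q p]

theorem smul_aux {n : ℕ} (p : ℤ) (c : ℚ) (x : Fin n → ℚ) :
    c.num • (p • x) = (p * (c.den : ℤ)) • (c • x) := by
  funext i
  have h : (c.den : ℚ) * c = c.num := Rat.den_mul_eq_num c
  simp only [Pi.smul_apply, zsmul_eq_mul, smul_eq_mul, Pi.mul_apply, Pi.intCast_apply]
  push_cast
  rw [← h]; ring

theorem RelQ.smul {n : ℕ} {V W : AddSubgroup (Fin n → ℤ)} {φ : V ≃+ W} {x y : Fin n → ℚ}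
    (c : ℚ) (h : RelQ V W φ x y) : RelQ V W φ (c • x) (c • y) := by
  obtain ⟨p, hp, v, h1, h2⟩ := h
  refine ⟨p * (c.den : ℤ), mul_ne_zero hp (by exact_mod_cast c.den_nz), c.num • v, ?_, ?_⟩
  · rw [AddSubgroup.coe_zsmul, embQ_zsmul, h1, smul_aux]
  · rw [map_zsmul, AddSubgroup.coe_zsmul, embQ_zsmul, h2, smul_aux]

theorem RelQ.zero {n : ℕ} (V W : AddSubgroup (Fin n → ℤ)) (φ : V ≃+ W) : RelQ V W φ 0 0 := by
  refine ⟨1, one_ne_zero, 0, ?_, ?_⟩ <;> · funext i; simp [embQ]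

theorem RelQ.left_zero {n : ℕ} {V W : AddSubgroup (Fin n → ℤ)} {φ : V ≃+ W} {y : Fin n → ℚ}
    (h : RelQ V W φ 0 y) : y = 0 := by
  obtain ⟨p, hp, v, h1, h2⟩ := h
  have hv : v = 0 := Subtype.ext (embQ_inj n (by rw [h1]; funext i; simp [embQ]))
  subst hv
  have : p • y = 0 := by rw [← h2]; funext i; simp [embQ]
  exact (smul_eq_zero.mp this).resolve_left hp

theorem RelQ.right_zero {n : ℕ} {V W : AddSubgroup (Fin n → ℤ)} {φ : V ≃+ W} {x : Fin n → ℚ}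
    (h : RelQ V W φ x 0) : x = 0 := by
  obtain ⟨p, hp, v, h1, h2⟩ := h
  have hw : φ v = 0 := Subtype.ext (embQ_inj n (by rw [h2]; funext i; simp [embQ]))
  have hv : v = 0 := by simpa using hw
  subst hv
  have : p • x = 0 := by rw [← h1]; funext i; simp [embQ]
  exact (smul_eq_zero.mp this).resolve_left hp

theorem RelQ.sub {n : ℕ} {V W : AddSubgroup (Fin n → ℤ)} {φ : V ≃+ W} {x y x' y' : Fin n → ℚ}
    (h : RelQ V W φ x y) (h' : RelQ V W φ x' y') : RelQ V W φ (x - x') (y - y') := by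
  have := h.add (h'.smul (-1))
  simpa [sub_eq_add_neg] using this

theorem RelQ.inj {n : ℕ} {V W : AddSubgroup (Fin n → ℤ)} {φ : V ≃+ W} {x x' y : Fin n → ℚ}
    (h : RelQ V W φ x y) (h' : RelQ V W φ x' y) : x = x' := by
  have := h.sub h'
  rw [sub_self] at this
  exact sub_eq_zero.mp this.right_zero

/-- `D_φ` as a subspace. -/
def DSub {n : ℕ} (V W : AddSubgroup (Fin n → ℤ)) (φ : V ≃+ W) : Submodule ℚ (Fin n → ℚ) where
  carrier := DSet V W φ
  zero_mem' := ⟨fun _ => 0, rfl, fun _ => Submodule.zero_mem _, fun _ => RelQ.zero V W φ⟩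
  add_mem' := by
    rintro a b ⟨xs, h0, h1, h2⟩ ⟨ys, g0, g1, g2⟩
    exact ⟨fun k => xs k + ys k, by simp only [h0, g0], fun k => Submodule.add_mem _ (h1 k) (g1 k),
      fun k => (h2 k).add (g2 k)⟩
  smul_mem' := by
    rintro c a ⟨xs, h0, h1, h2⟩
    exact ⟨fun k => c • xs k, by simp only [h0], fun k => Submodule.smul_mem _ c (h1 k),
      fun k => (h2 k).smul c⟩

theorem DSub_exists {n : ℕ} (V W : AddSubgroup (Fin n → ℤ)) (φ : V ≃+ W) (x : DSub V W φ) :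
    ∃ y : DSub V W φ, RelQ V W φ (y : Fin n → ℚ) (x : Fin n → ℚ) := by
  obtain ⟨x, xs, h0, h1, h2⟩ := x
  refine ⟨⟨xs 1, fun k => xs (k + 1), rfl, fun k => h1 _, fun k => h2 _⟩, ?_⟩
  have := h2 0
  rwa [h0] at this

/-- Proposition 7.1(1): `D_φ` is a `φ_ℚ`-invariant `ℚ`-subspace of `M ⊗ ℚ`, and the
restriction `φ̃` of `φ_ℚ` to `D_φ` is a `ℚ`-linear automorphism of `D_φ` (it maps `D_φ`
bijectively onto `D_φ`). -/
theorem statement0 (n : ℕ) (V W : AddSubgroup (Fin n → ℤ)) (φ : V ≃+ W) :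
    ∃ D : Submodule ℚ (Fin n → ℚ), (D : Set (Fin n → ℚ)) = DSet V W φ ∧
      ∃ e : D ≃ₗ[ℚ] D, ∀ x : D, RelQ V W φ (x : Fin n → ℚ) ((e x : D) : Fin n → ℚ) := by
  refine ⟨DSub V W φ, rfl, ?_⟩
  choose f hf using DSub_exists V W φ
  let g : DSub V W φ →ₗ[ℚ] DSub V W φ :=
    { toFun := f
      map_add' := fun x y => Subtype.ext ((hf (x + y)).inj ((hf x).add (hf y)))
      map_smul' := fun c x => Subtype.ext ((hf (c • x)).inj ((hf x).smul c)) }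
  have hg : Function.Injective g := by
    rw [injective_iff_map_eq_zero]
    intro x hx
    have h := hf x
    have hx' : f x = 0 := hx
    rw [hx'] at h
    exact Subtype.ext (RelQ.left_zero h)
  let e := LinearEquiv.ofInjectiveEndo g hg
  refine ⟨e.symm, fun x => ?_⟩
  have h := hf (e.symm x)
  have h2 : f (e.symm x) = x := e.apply_symm_apply x
  rwa [h2] at h
end

section
/- Let Γ be a finite connected graph with vertex set V and oriented edge set E equipped with a fixed-point-free involution e ↦ ē reversing orientation (with initial vertex i(e) and terminal vertex t(e) satisfying i(ē) = t(e)), let A ⊆ E be the edge set of a spanning tree of Γ closed under the involution, and let σ : E → ℤ∖{0}; write τ_e = σ_{ē}. Let G be the group with presentation whose generators are {a_v : v ∈ V} ∪ {t_e : e ∈ E} and whose relations are: t_{ē} = t_e^{-1} for all e ∈ E; t_e a_{i(e)}^{σ_e} t_e^{-1} = a_{t(e)}^{τ_e} for all e ∈ E; and t_e = 1 for all e ∈ A. Then for all vertices v, v' and all integers m, n, the elements a_v^m and a_{v'}^n are conjugate in G if and only if there exists a finite sequence (m_0, w_0) = (m, v), (m_1, w_1), …, (m_s, w_s) = (n, v')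 of pairs in ℤ × V such that for every i < s there is an edge e ∈ E with i(e) = w_i, t(e) = w_{i+1}, σ_e divides m_i, and m_{i+1}·σ_e = m_i·τ_e. -/
/-- `PathIn ini ter S v v'`: there is an edge path from `v` to `v'` using only edges
from the set `S` (edges are oriented, with initial vertex `ini e` and terminal vertex
`ter e`). -/
def PathIn {Vtx Edg : Type} (ini ter : Edg → Vtx) (S : Set Edg) (v v' : Vtx) : Prop :=
  ∃ s : ℕ, ∃ es : Fin s → Edg, ∃ vs : Fin (s + 1) → Vtx,
    vs 0 = v ∧ vs (Fin.last s) = v' ∧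
    ∀ j : Fin s, es j ∈ S ∧ ini (es j) = vs j.castSucc ∧ ter (es j) = vs j.succ

/-- The relators of the presentation of the fundamental group of a GBS graph of groups,
relative to the spanning tree with edge set `A`: the generator `Sum.inl v` is the
generator `a_v` of the vertex group at `v`, and `Sum.inr e` is the stable letter `t_e`.
Relators: `t_{ē} t_e` (i.e. `t_{ē} = t_e⁻¹`); `t_e a_{i(e)}^{σ_e} t_e⁻¹ a_{t(e)}^{-τ_e}`
with `τ_e = σ_{ē}` (i.e. `t_e a_{i(e)}^{σ_e} t_e⁻¹ = a_{t(e)}^{τ_e}`); and `t_e` for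
`e ∈ A`. -/
def GBSRels {Vtx Edg : Type} (bar : Edg → Edg) (ini ter : Edg → Vtx)
    (σ : Edg → ℤ) (A : Set Edg) : Set (FreeGroup (Vtx ⊕ Edg)) :=
  {r | (∃ e : Edg, r = FreeGroup.of (Sum.inr (bar e)) * FreeGroup.of (Sum.inr e)) ∨
       (∃ e : Edg,
         r = FreeGroup.of (Sum.inr e) * (FreeGroup.of (Sum.inl (ini e))) ^ (σ e) *
             (FreeGroup.of (Sum.inr e))⁻¹ *
             (FreeGroup.of (Sum.inl (ter e))) ^ (-(σ (bar e)))) ∨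
       (∃ e ∈ A, r = FreeGroup.of (Sum.inr e))}

open HNNExtension HNNExtension.NormalWord in
/-- Right multiplication of a nonempty reduced word by an element of the base group. -/
theorem gbs_append {K : Type} [Group K] {A B : Subgroup K} (φ : A ≃* B)
    (l : List (ℤˣ × K)) (hl : l ≠ [])
    (hc : l.IsChain (fun a b => a.2 ∈ toSubgroup A B a.1 → a.1 = b.1)) (x : K) :
    ∃ l' : List (ℤˣ × K), l'.IsChain (fun a b => a.2 ∈ toSubgroup A B a.1 → a.1 = b.1) ∧
      (l'.map (fun x => (t ^ (x.1 : ℤ) * of x.2 : HNNExtension K A B φ))).prod =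
      (l.map (fun x => (t ^ (x.1 : ℤ) * of x.2 : HNNExtension K A B φ))).prod * of x := by
  induction l using List.reverseRecOn with
  | nil => exact absurd rfl hl
  | append_singleton l a _ =>
    refine ⟨l ++ [(a.1, a.2 * x)], ?_, ?_⟩
    · rw [List.isChain_append] at hc ⊢
      refine ⟨hc.1, by simp, ?_⟩
      intro p hp q hq
      simp only [List.head?_cons, Option.mem_def, Option.some.injEq] at hq
      subst hq
      exact hc.2.2 p hp a (by simp)
    · simp [mul_assoc]

open HNNExtension HNNExtension.NormalWord in
theorem gbs_hnn_aux {K : Type} [Group K] {A B : Subgroup K} (φ : A ≃* B)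
    (P : K → K → Prop) (htrans : ∀ x y z, P x y → P y z → P x z)
    (hconj : ∀ g x, P x (g * x * g⁻¹)) (h1 : ∀ a : A, P a (φ a)) (h2 : ∀ a : A, P (φ a) a)
    (l : List (ℤˣ × K)) : ∀ (h : K)
    (_ : l.IsChain (fun a b => a.2 ∈ toSubgroup A B a.1 → a.1 = b.1)) (x y : K),
    (of h * (l.map (fun x => (t ^ (x.1 : ℤ) * of x.2 : HNNExtension K A B φ))).prod) * of x =
    of y * (of h * (l.map (fun x => (t ^ (x.1 : ℤ) * of x.2 : HNNExtension K A B φ))).prod) →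
    P x y := by
  induction l with
  | nil =>
    intro h _ x y hxy
    simp only [List.map_nil, List.prod_nil, mul_one, ← map_mul] at hxy
    have := of_injective φ hxy
    have hy : y = h * x * h⁻¹ := by rw [this]; group
    rw [hy]; exact hconj _ _
  | cons p l ih =>
    intro h hc x y hxy
    obtain ⟨u, g⟩ := p
    obtain ⟨l', hl', hprod⟩ := gbs_append φ ((u, g) :: l) (by simp) hc x
    have key := (ReducedWord.map_fst_eq_and_of_prod_eq (A := A) (B := B) φ
      (w₁ := ⟨y * h, (u, g) :: l, hc⟩) (w₂ := ⟨h, l', hl'⟩) (by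
        simp only [ReducedWord.prod]
        rw [hprod, map_mul, mul_assoc, ← hxy, mul_assoc])).2 u (by simp)
    have hmem : h⁻¹ * y * h ∈ toSubgroup A B (-u) := by
      have := inv_mem key
      simpa [mul_assoc] using this
    have hex : ∃ c' : K, P c' (h⁻¹ * y * h) ∧
        (of (h⁻¹ * y * h) : HNNExtension K A B φ) * t ^ (u : ℤ) = t ^ (u : ℤ) * of c' := by
      rcases Int.units_eq_one_or u with rfl | rfl
      · rw [toSubgroup_neg_one] at hmem
        refine ⟨φ.symm ⟨_, hmem⟩, ?_, ?_⟩
        · simpa using h1 (φ.symm ⟨_, hmem⟩)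
        · simpa using of_mul_t (φ := φ) ⟨_, hmem⟩
      · rw [neg_neg, toSubgroup_one] at hmem
        refine ⟨φ ⟨_, hmem⟩, ?_, ?_⟩
        · simpa using h2 ⟨_, hmem⟩
        · simpa using of_mul_inv_t (φ := φ) ⟨_, hmem⟩
    obtain ⟨c', hP, hc'⟩ := hex
    have hxc : P x c' := by
      refine ih g (List.isChain_cons.1 hc).2 x c' ?_
      simp only [List.map_cons, List.prod_cons] at hxy
      generalize (l.map (fun x => (t ^ (x.1 : ℤ) * of x.2 : HNNExtension K A B φ))).prod = L at hxy ⊢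
      simp only [map_mul, map_inv] at hc'
      have e1 : (t ^ (u : ℤ) : HNNExtension K A B φ) * (of g * L * of x)
          = t ^ (u : ℤ) * (of c' * (of g * L)) := by
        calc (t ^ (u : ℤ) : HNNExtension K A B φ) * (of g * L * of x)
            = (of h)⁻¹ * (of h * (t ^ (u : ℤ) * of g * L) * of x) := by group
          _ = ((of h)⁻¹ * of y * of h * t ^ (u : ℤ)) * (of g * L) := by rw [hxy]; group
          _ = _ := by rw [hc']; group
      exact mul_left_cancel e1
    refine htrans _ _ _ hxc (htrans _ _ _ hP ?_)
    have := hconj h (h⁻¹ * y * h)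
    have e : h * (h⁻¹ * y * h) * h⁻¹ = y := by group
    rwa [e] at this

open HNNExtension HNNExtension.NormalWord in
theorem gbs_hnn {K : Type} [Group K] {A B : Subgroup K} (φ : A ≃* B)
    (P : K → K → Prop) (htrans : ∀ x y z, P x y → P y z → P x z)
    (hconj : ∀ g x, P x (g * x * g⁻¹)) (h1 : ∀ a : A, P a (φ a)) (h2 : ∀ a : A, P (φ a) a)
    (x y : K) (hxy : IsConj (of x : HNNExtension K A B φ) (of y)) : P x y := by
  obtain ⟨g, hg⟩ := isConj_iff.1 hxy
  obtain ⟨d⟩ := TransversalPair.nonempty K A B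
  obtain ⟨w, hw⟩ : ∃ w : NormalWord d, w.prod φ = g := ⟨_, (NormalWord.equiv φ d).left_inv g⟩
  refine gbs_hnn_aux φ P htrans hconj h1 h2 w.toList w.head w.chain x y ?_
  change w.prod φ * of x = of y * w.prod φ
  rw [hw, ← hg]; group

/-- One step of a conjugating sequence. -/
def GBSStep {Vtx Edg : Type} (bar : Edg → Edg) (ini ter : Edg → Vtx) (σ : Edg → ℤ)
    (p q : ℤ × Vtx) : Prop :=
  ∃ e : Edg, ini e = p.2 ∧ ter e = q.2 ∧ σ e ∣ p.1 ∧ q.1 * σ e = p.1 * σ (bar e)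

/-- Adjoining a letter conjugating one element of infinite order to another. -/
theorem gbs_adjoin {K : Type} [Group K] (c d : K)
    (hc : ∀ k : ℤ, c ^ k = 1 → k = 0) (hd : ∀ k : ℤ, d ^ k = 1 → k = 0) :
    ∃ (L : Type) (_ : Group L) (f : K →* L), IsConj (f c) (f d) ∧
      ∀ P : K → K → Prop, (∀ x y z, P x y → P y z → P x z) → (∀ g x, P x (g * x * g⁻¹)) →
        (∀ k : ℤ, P (c ^ k) (d ^ k)) → (∀ k : ℤ, P (d ^ k) (c ^ k)) →
        ∀ x y, IsConj (f x) (f y) → P x y := by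
  have inj : ∀ c : K, (∀ k : ℤ, c ^ k = 1 → k = 0) →
      Function.Injective (zpowersHom K c) := by
    intro c hc
    rw [injective_iff_map_eq_one]
    intro a ha
    exact hc _ ha
  let φ := (MonoidHom.ofInjective (inj c hc)).symm.trans (MonoidHom.ofInjective (inj d hd))
  have hφ : ∀ k, φ (MonoidHom.ofInjective (inj c hc) k) = MonoidHom.ofInjective (inj d hd) k := by
    intro k; simp [φ]
  refine ⟨HNNExtension K _ _ φ, inferInstance, HNNExtension.of, ?_, ?_⟩
  · rw [isConj_iff]
    refine ⟨HNNExtension.t, ?_⟩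
    have := HNNExtension.equiv_eq_conj (φ := φ)
      (MonoidHom.ofInjective (inj c hc) (Multiplicative.ofAdd 1))
    rw [hφ] at this
    have e : ∀ c : K, zpowersHom K c (Multiplicative.ofAdd 1) = c := fun c => by simp
    rw [MonoidHom.ofInjective_apply, MonoidHom.ofInjective_apply, e, e] at this
    exact this.symm
  · intro P ht hconj h1 h2 x y hxy
    refine gbs_hnn φ P ht hconj ?_ ?_ x y hxy
    · intro a
      obtain ⟨k, rfl⟩ := (MonoidHom.ofInjective (inj c hc)).surjective a
      rw [hφ]; exact h1 k.toAdd
    · intro a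
      obtain ⟨k, rfl⟩ := (MonoidHom.ofInjective (inj c hc)).surjective a
      rw [hφ]; exact h2 k.toAdd

/-- The main construction: a group in which all edge relations hold up to conjugacy and in
which conjugacy of powers of the `a v` implies the given relation. -/
theorem gbs_build {Vtx Edg : Type} [Fintype Vtx] (bar : Edg → Edg) (ini ter : Edg → Vtx)
    (σ : Edg → ℤ) (hσ : ∀ e, σ e ≠ 0)
    (R : ℤ × Vtx → ℤ × Vtx → Prop) (hrefl : ∀ x, R x x)
    (htr : ∀ x y z, R x y → R y z → R x z)
    (hz : ∀ v w, R (0, v) (0, w)) (hz' : ∀ m v w, R (m, v) (0, w) → m = 0)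
    (he : ∀ e k, R (σ e * k, ini e) (σ (bar e) * k, ter e))
    (he' : ∀ e k, R (σ (bar e) * k, ter e) (σ e * k, ini e))
    (S : Finset Edg) :
    ∃ (K : Type) (_ : Group K) (a : Vtx → K),
      (∀ e ∈ S, IsConj (a (ini e) ^ σ e) (a (ter e) ^ σ (bar e))) ∧
      ∀ v w m n, IsConj (a v ^ m) (a w ^ n) → R (m, v) (n, w) := by
  classical
  induction S using Finset.induction_on with
  | empty =>
    refine ⟨Vtx → Multiplicative ℤ, inferInstance,
      fun v => Pi.mulSingle v (Multiplicative.ofAdd 1), by simp, ?_⟩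
    intro v w m n h
    rw [isConj_iff_eq] at h
    have hv := congrFun h v
    have hw := congrFun h w
    by_cases hvw : v = w
    · subst hvw
      have : m = n := by
        have := congrArg Multiplicative.toAdd hv
        simpa using this
      subst this; exact hrefl _
    · have h1 : m = 0 := by
        have := congrArg Multiplicative.toAdd hv
        simpa [Pi.mulSingle_eq_of_ne hvw] using this
      have h2 : 0 = n := by
        have := congrArg Multiplicative.toAdd hw
        simpa [Pi.mulSingle_eq_of_ne (Ne.symm hvw)] using this
      subst h1 h2; exact hz _ _
  | insert e S _ ih =>
    obtain ⟨K, _, a, hS, hdet⟩ := ih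
    have hinf : ∀ v (s : ℤ), s ≠ 0 → ∀ k : ℤ, (a v ^ s) ^ k = 1 → k = 0 := by
      intro v s hs k hk
      have := hz' _ _ _ (hdet v v (s * k) 0 (by rw [zpow_mul, hk, zpow_zero]))
      exact (mul_eq_zero.1 this).resolve_left hs
    obtain ⟨L, _, f, hf, hP⟩ := gbs_adjoin (a (ini e) ^ σ e) (a (ter e) ^ σ (bar e))
      (hinf _ _ (hσ _)) (hinf _ _ (hσ _))
    refine ⟨L, inferInstance, fun v => f (a v), ?_, ?_⟩
    · intro e' he'
      rcases Finset.mem_insert.1 he' with rfl | h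
      · simpa using hf
      · simpa using f.map_isConj (hS e' h)
    · intro v w m n h
      obtain ⟨w', n', h1, h2⟩ := hP (fun x y => ∀ v m, IsConj x (a v ^ m) →
          ∃ w n, IsConj y (a w ^ n) ∧ R (m, v) (n, w)) (by
            intro x y z hxy hyz v m h
            obtain ⟨w, n, h1, h2⟩ := hxy v m h
            obtain ⟨w', n', h3, h4⟩ := hyz w n h1
            exact ⟨w', n', h3, htr _ _ _ h2 h4⟩) (by
            intro g x v m h
            exact ⟨v, m, (isConj_iff.2 ⟨g, rfl⟩ : IsConj x (g * x * g⁻¹)).symm.trans h,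
              hrefl _⟩) (by
            intro k v m h
            rw [← zpow_mul] at h
            exact ⟨ter e, σ (bar e) * k, by rw [zpow_mul],
              htr _ _ _ (hdet _ _ _ _ h.symm) (he e k)⟩) (by
            intro k v m h
            rw [← zpow_mul] at h
            exact ⟨ini e, σ e * k, by rw [zpow_mul],
              htr _ _ _ (hdet _ _ _ _ h.symm) (he' e k)⟩)
          (a v ^ m) (a w ^ n) (by simpa using h) v m (IsConj.refl _)
      exact htr _ _ _ h2 (hdet _ _ _ _ h1.symm)

/-- Existence of a potential on a spanning tree. -/
theorem gbs_potential {Vtx Edg K : Type} [Fintype Vtx] [Group K]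
    (bar : Edg → Edg) (ini ter : Edg → Vtx)
    (hbar : ∀ e, bar (bar e) = e) (hfree : ∀ e, bar e ≠ e)
    (hit : ∀ e, ini (bar e) = ter e)
    (A : Finset Edg) (hAbar : ∀ e ∈ A, bar e ∈ A)
    (hAconn : ∀ v v' : Vtx, PathIn ini ter (A : Set Edg) v v')
    (hAcard : A.card + 2 = 2 * Fintype.card Vtx)
    (t : Edg → K) (ht : ∀ e, t (bar e) = (t e)⁻¹) :
    ∃ p : Vtx → K, ∀ e ∈ A, p (ter e) = t e * p (ini e) := by
  classical
  have hti : ∀ e, ter (bar e) = ini e := fun e => by rw [← hit, hbar]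
  have main : ∀ k : ℕ, k + 1 ≤ Fintype.card Vtx → ∃ (W : Finset Vtx) (B : Finset Edg) (p : Vtx → K),
      W.card = k + 1 ∧ B ⊆ A ∧ B.card = 2 * k ∧
      (∀ e ∈ B, ini e ∈ W ∧ ter e ∈ W) ∧ ∀ e ∈ B, p (ter e) = t e * p (ini e) := by
    intro k
    induction k with
    | zero =>
      intro h
      obtain ⟨v⟩ := Fintype.card_pos_iff.1 (Nat.lt_of_lt_of_le Nat.zero_lt_one h)
      exact ⟨{v}, ∅, 1, by simp⟩
    | succ k ih =>
      intro h
      obtain ⟨W, B, p, hW, hBA, hB, hBW, hp⟩ := ih (by omega)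
      obtain ⟨v, hv⟩ : W.Nonempty := by rw [← Finset.card_pos]; omega
      obtain ⟨v', hv'⟩ : ∃ v', v' ∉ W := by
        by_contra hcon
        push Not at hcon
        have : W = Finset.univ := by ext; simp [hcon]
        rw [this, Finset.card_univ] at hW
        omega
      obtain ⟨e, heA, hei, het⟩ : ∃ e ∈ A, ini e ∈ W ∧ ter e ∉ W := by
        by_contra hcon
        push Not at hcon
        obtain ⟨s, es, vs, h0, hl, hj⟩ := hAconn v v'
        have : ∀ i, vs i ∈ W := by
          intro i
          induction i using Fin.induction with
          | zero => rwa [h0]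
          | succ i hi =>
            obtain ⟨h1, h2, h3⟩ := hj i
            rw [← h3]; exact hcon _ h1 (by rw [h2]; exact hi)
        exact hv' (hl ▸ this _)
      have heB : e ∉ B := fun h => het (hBW e h).2
      have hbB : bar e ∉ B := fun h => het (hit e ▸ (hBW _ h).1)
      have hne : ini e ≠ ter e := fun h => het (h ▸ hei)
      refine ⟨insert (ter e) W, insert e (insert (bar e) B),
        Function.update p (ter e) (t e * p (ini e)), ?_, ?_, ?_, ?_, ?_⟩
      · rw [Finset.card_insert_of_notMem het, hW]
      · intro x hx
        simp only [Finset.mem_insert] at hx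
        rcases hx with rfl | rfl | hx
        · exact heA
        · exact hAbar _ heA
        · exact hBA hx
      · rw [Finset.card_insert_of_notMem, Finset.card_insert_of_notMem hbB, hB]
        · ring
        · simp only [Finset.mem_insert, not_or]
          exact ⟨(hfree e).symm, heB⟩
      · intro x hx
        simp only [Finset.mem_insert] at hx ⊢
        rcases hx with rfl | rfl | hx
        · exact ⟨Or.inr hei, Or.inl rfl⟩
        · rw [hit, hti]; exact ⟨Or.inl rfl, Or.inr hei⟩
        · exact ⟨Or.inr (hBW x hx).1, Or.inr (hBW x hx).2⟩
      · intro x hx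
        simp only [Finset.mem_insert] at hx
        rcases hx with rfl | rfl | hx
        · rw [Function.update_self, Function.update_of_ne hne]
        · rw [hit, hti, Function.update_self, Function.update_of_ne hne, ht]; group
        · have n1 : ini x ≠ ter e := fun h => het (h ▸ (hBW x hx).1)
          have n2 : ter x ≠ ter e := fun h => het (h ▸ (hBW x hx).2)
          rw [Function.update_of_ne n1, Function.update_of_ne n2, hp x hx]
  obtain ⟨W, B, p, hW, hBA, hB, hBW, hp⟩ := main (Fintype.card Vtx - 1) (by omega)
  have : B = A := Finset.eq_of_subset_of_card_le hBA (by omega)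
  subst this
  exact ⟨p, hp⟩

/-- A reflexive transitive chain as a sequence indexed by `Fin`. -/
theorem gbs_chain {α : Type} (r : α → α → Prop) (x y : α) :
    Relation.ReflTransGen r x y ↔ ∃ s : ℕ, ∃ f : Fin (s + 1) → α, f 0 = x ∧ f (Fin.last s) = y ∧
      ∀ j : Fin s, r (f j.castSucc) (f j.succ) := by
  constructor
  · intro h
    induction h using Relation.ReflTransGen.head_induction_on with
    | refl => exact ⟨0, fun _ => y, rfl, rfl, fun j => j.elim0⟩
    | head h1 _ ih =>
      rename_i a c _
      obtain ⟨s, f, h0, hl, hj⟩ := ih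
      refine ⟨s + 1, Fin.cons a f, rfl, ?_, ?_⟩
      · rw [← Fin.succ_last, Fin.cons_succ, hl]
      · intro j
        refine Fin.cases ?_ (fun i => ?_) j
        · simpa [h0] using h1
        · rw [← Fin.succ_castSucc, Fin.cons_succ, Fin.cons_succ]; exact hj i
  · rintro ⟨s, f, rfl, rfl, hj⟩
    have : ∀ i, Relation.ReflTransGen r (f 0) (f i) := by
      intro i
      induction i using Fin.induction with
      | zero => exact .refl
      | succ i hi => exact hi.tail (hj i)
    exact this _

/-- Theorem 9.2: let `Γ` be a finite connected graph (vertices `Vtx`, oriented edges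
`Edg` with a fixed-point-free orientation-reversing involution `bar`, `ini (bar e) = ter e`),
let `A` be the edge set of a spanning tree (closed under `bar`, connecting all vertices,
and with `|A| = 2 (|Vtx| - 1)` -- so the corresponding geometric subgraph is a tree),
and let `σ : Edg → ℤ∖{0}`, `τ_e = σ_{ē}`.  In the GBS group `G` presented as above,
`a_v^m` and `a_{v'}^n` are conjugate if and only if there is a conjugating sequence
`(m_0, w_0) = (m, v), …, (m_s, w_s) = (n, v')`: for each `j < s` there is an edge `e`
from `w_j` to `w_{j+1}` with `σ_e ∣ m_j` and `m_{j+1} σ_e = m_j τ_e`. -/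
theorem statement9 (Vtx Edg : Type) [Fintype Vtx] [Fintype Edg]
    (bar : Edg → Edg) (ini ter : Edg → Vtx)
    (hbar : ∀ e, bar (bar e) = e) (hfree : ∀ e, bar e ≠ e)
    (hit : ∀ e, ini (bar e) = ter e)
    (σ : Edg → ℤ) (hσ : ∀ e, σ e ≠ 0)
    (A : Finset Edg) (hAbar : ∀ e ∈ A, bar e ∈ A)
    (hAconn : ∀ v v' : Vtx, PathIn ini ter (A : Set Edg) v v')
    (hAcard : A.card + 2 = 2 * Fintype.card Vtx)
    (v v' : Vtx) (m n : ℤ) :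
    IsConj
        ((PresentedGroup.of (Sum.inl v) :
            PresentedGroup (GBSRels bar ini ter σ (A : Set Edg))) ^ m)
        ((PresentedGroup.of (Sum.inl v') :
            PresentedGroup (GBSRels bar ini ter σ (A : Set Edg))) ^ n) ↔
      ∃ s : ℕ, ∃ ms : Fin (s + 1) → ℤ, ∃ ws : Fin (s + 1) → Vtx,
        ms 0 = m ∧ ws 0 = v ∧ ms (Fin.last s) = n ∧ ws (Fin.last s) = v' ∧
        ∀ j : Fin s, ∃ e : Edg,
          ini e = ws j.castSucc ∧ ter e = ws j.succ ∧
          σ e ∣ ms j.castSucc ∧ ms j.succ * σ e = ms j.castSucc * σ (bar e) := by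
    classical
  have hti : ∀ e, ter (bar e) = ini e := fun e => by rw [← hit, hbar]
  have hiff : (∃ s : ℕ, ∃ ms : Fin (s + 1) → ℤ, ∃ ws : Fin (s + 1) → Vtx,
        ms 0 = m ∧ ws 0 = v ∧ ms (Fin.last s) = n ∧ ws (Fin.last s) = v' ∧
        ∀ j : Fin s, ∃ e : Edg,
          ini e = ws j.castSucc ∧ ter e = ws j.succ ∧
          σ e ∣ ms j.castSucc ∧ ms j.succ * σ e = ms j.castSucc * σ (bar e)) ↔
      Relation.ReflTransGen (GBSStep bar ini ter σ) (m, v) (n, v') := by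
    rw [gbs_chain]
    constructor
    · rintro ⟨s, ms, ws, h1, h2, h3, h4, h5⟩
      exact ⟨s, fun i => (ms i, ws i), by simp [h1, h2], by simp [h3, h4], h5⟩
    · rintro ⟨s, f, h1, h2, h3⟩
      exact ⟨s, fun i => (f i).1, fun i => (f i).2, by simp [h1], by simp [h1], by simp [h2],
        by simp [h2], h3⟩
  rw [hiff]
  have hstep : ∀ e k, GBSStep bar ini ter σ (σ e * k, ini e) (σ (bar e) * k, ter e) :=
    fun e k => ⟨e, rfl, rfl, Dvd.intro _ rfl, by ring⟩
  constructor
  · intro hG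
    obtain ⟨K, _, a, hS, hdet⟩ := gbs_build bar ini ter σ hσ
      (Relation.ReflTransGen (GBSStep bar ini ter σ)) (fun _ => .refl)
      (fun _ _ _ h1 h2 => h1.trans h2)
      (by
        intro v w
        obtain ⟨s, es, vs, h0, hl, hj⟩ := hAconn v w
        rw [gbs_chain]
        exact ⟨s, fun i => (0, vs i), by simp [h0], by simp [hl],
          fun j => ⟨es j, (hj j).2.1, (hj j).2.2, dvd_zero _, by simp⟩⟩)
      (by
        intro m v w h
        have : ∀ x y, Relation.ReflTransGen (GBSStep bar ini ter σ) x y → y.1 = 0 → x.1 = 0 := by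
          intro x y h hy
          induction h using Relation.ReflTransGen.head_induction_on with
          | refl => exact hy
          | head h1 _ ih =>
            obtain ⟨e, _, _, _, h4⟩ := h1
            rw [ih, zero_mul] at h4
            exact (mul_eq_zero.1 h4.symm).resolve_right (hσ _)
        exact this _ _ h rfl)
      (fun e k => .single (hstep e k))
      (fun e k => .single (by
        have := hstep (bar e) k
        rwa [hbar, hit, hti] at this))
      Finset.univ
    have hc : ∀ e, ∃ c : K, c * a (ini e) ^ σ e * c⁻¹ = a (ter e) ^ σ (bar e) :=
      fun e => isConj_iff.1 (hS e (Finset.mem_univ e))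
    choose c hc using hc
    let o : Edg ≃ Fin (Fintype.card Edg) := Fintype.equivFin Edg
    let t : Edg → K := fun e => if o e < o (bar e) then c e else (c (bar e))⁻¹
    have ht : ∀ e, t (bar e) = (t e)⁻¹ := by
      intro e
      have hne : o (bar e) ≠ o e := fun h => hfree e (o.injective h)
      simp only [t, hbar]
      rcases lt_or_gt_of_ne hne with h | h
      · rw [if_pos h, if_neg (not_lt.2 h.le), inv_inv]
      · rw [if_pos h, if_neg (not_lt.2 h.le)]
    have htc : ∀ e, t e * a (ini e) ^ σ e * (t e)⁻¹ = a (ter e) ^ σ (bar e) := by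
      intro e
      simp only [t]
      split_ifs with h
      · exact hc e
      · have := hc (bar e)
        rw [hit, hti, hbar] at this
        rw [← this]; group
    obtain ⟨p, hp⟩ := gbs_potential bar ini ter hbar hfree hit A hAbar hAconn hAcard t ht
    let F : Vtx ⊕ Edg → K := Sum.elim (fun v => (p v)⁻¹ * a v * p v)
      (fun e => (p (ter e))⁻¹ * t e * p (ini e))
    have hpow : ∀ v (k : ℤ), ((p v)⁻¹ * a v * p v) ^ k = (p v)⁻¹ * a v ^ k * p v := by
      intro v k
      simpa using conj_zpow (a := (p v)⁻¹) (b := a v) (i := k)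
    have hF : ∀ r ∈ GBSRels bar ini ter σ (A : Set Edg), FreeGroup.lift F r = 1 := by
      rintro r (⟨e, rfl⟩ | ⟨e, rfl⟩ | ⟨e, he, rfl⟩)
      · simp only [map_mul, FreeGroup.lift_apply_of, F, Sum.elim_inr, hit, hti, ht]
        group
      · simp only [map_mul, map_inv, map_zpow, FreeGroup.lift_apply_of, F, Sum.elim_inr,
          Sum.elim_inl, hpow, zpow_neg]
        rw [← htc]; group
      · simp only [FreeGroup.lift_apply_of, F, Sum.elim_inr]
        rw [hp e he]; group
    have hK := (PresentedGroup.toGroup hF).map_isConj hG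
    simp only [map_zpow, PresentedGroup.toGroup.of, F, Sum.elim_inl, hpow] at hK
    refine hdet _ _ _ _ ?_
    have hcj : ∀ v (k : ℤ), IsConj (a v ^ k) ((p v)⁻¹ * a v ^ k * p v) :=
      fun v k => isConj_iff.2 ⟨(p v)⁻¹, by group⟩
    exact (hcj v m).trans (hK.trans (hcj v' n).symm)
  · intro h
    have key : ∀ x y, GBSStep bar ini ter σ x y →
        IsConj ((PresentedGroup.of (Sum.inl x.2) :
            PresentedGroup (GBSRels bar ini ter σ (A : Set Edg))) ^ x.1)
          ((PresentedGroup.of (Sum.inl y.2) :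
            PresentedGroup (GBSRels bar ini ter σ (A : Set Edg))) ^ y.1) := by
      rintro ⟨m, v⟩ ⟨n, w⟩ ⟨e, h1, h2, ⟨k, h3⟩, h4⟩
      simp only at h1 h2 h3 h4
      subst h1 h2 h3
      have hn : n = σ (bar e) * k := by
        apply mul_right_cancel₀ (hσ e)
        rw [h4]; ring
      subst hn
      have hrel : (PresentedGroup.of (Sum.inr e) :
            PresentedGroup (GBSRels bar ini ter σ (A : Set Edg))) *
          PresentedGroup.of (Sum.inl (ini e)) ^ σ e * (PresentedGroup.of (Sum.inr e))⁻¹ *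
          PresentedGroup.of (Sum.inl (ter e)) ^ (-(σ (bar e))) = 1 := by
        have := (PresentedGroup.one_of_mem (rels := GBSRels bar ini ter σ (A : Set Edg))
          (Or.inr (Or.inl ⟨e, rfl⟩)))
        simp only [map_mul, map_inv, map_zpow] at this
        exact this
      rw [zpow_neg, mul_inv_eq_one] at hrel
      rw [isConj_iff]
      refine ⟨PresentedGroup.of (Sum.inr e), ?_⟩
      simp only
      rw [zpow_mul, zpow_mul, ← hrel, conj_zpow]
    have : ∀ x y, Relation.ReflTransGen (GBSStep bar ini ter σ) x y →
        IsConj ((PresentedGroup.of (Sum.inl x.2) :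
            PresentedGroup (GBSRels bar ini ter σ (A : Set Edg))) ^ x.1)
          ((PresentedGroup.of (Sum.inl y.2) :
            PresentedGroup (GBSRels bar ini ter σ (A : Set Edg))) ^ y.1) := by
      intro x y h
      induction h with
      | refl => exact IsConj.refl _
      | tail _ h2 ih => exact ih.trans (key _ _ h2)
    exact this _ _ h
end
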